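/- arXiv:1803.09988 — 3 statements merged into one kernel-verified Lean document; each statement's English description precedes it below -/
import Mathlib

section
/- Let q be a prime power and let C be a linear code in GF(q)^n. Then C is minimal if and only if for every pair of GF(q)-linearly independent codewords a, b in C, the sum over all c in GF(q)\{0} of wt(a + c*b) is not equal to (q-1)*wt(a) - wt(b). -/
/-- The number of nonzero scalars `c` with `x + c * y ≠ 0`. -/
theorem sum_ite_add_mul_ne_zero {F : Type*} [Field F] [Fintype F] [DecidableEq F] (x y : F) :
    (∑ c ∈ (Finset.univ \ {0} : Finset F), if x + c * y ≠ 0 then (1 : ℤ) else 0) =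
      ((Fintype.card F : ℤ) - 1) * (if x ≠ 0 then 1 else 0) - (if y ≠ 0 then 1 else 0)
        + Fintype.card F * (if x = 0 ∧ y ≠ 0 then 1 else 0) := by
  have hcard : (∑ _c ∈ (Finset.univ \ {0} : Finset F), (1 : ℤ)) = (Fintype.card F : ℤ) - 1 := by
    have h := Finset.sum_sdiff_eq_sub (f := fun _ : F => (1 : ℤ)) (Finset.subset_univ {0})
    simpa using h
  by_cases hy : y = 0
  · by_cases hx : x = 0
    · simp [hx, hy]
    · simpa [hx, hy] using hcard
  · by_cases hx : x = 0
    · rw [Finset.sum_congr rfl (g := fun _ => (1 : ℤ)), hcard]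
      · simp [hx, hy]
        ring
      · intro c hc
        have hc0 : c ≠ 0 := by simpa using hc
        simp [hx, hy, hc0]
    · have hroot (c : F) : x + c * y = 0 ↔ c = -x / y := by
        rw [eq_div_iff hy, eq_neg_iff_add_eq_zero, add_comm]
      have hmem : -x / y ∈ (Finset.univ \ {0} : Finset F) := by simp [hx, hy]
      have hsplit (c : F) : (if x + c * y ≠ 0 then (1 : ℤ) else 0) =
          1 - if c = -x / y then 1 else 0 := by
        by_cases h : c = -x / y <;> simp [hroot, h]
      rw [Finset.sum_congr rfl fun c _ => hsplit c, Finset.sum_sub_distrib, hcard,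
        Finset.sum_ite_eq', if_pos hmem]
      simp [hx, hy]

theorem hammingNorm_eq_sum_ite {ι F : Type*} [Fintype ι] [Zero F] [DecidableEq F] (v : ι → F) :
    (hammingNorm v : ℤ) = ∑ i, if v i ≠ 0 then (1 : ℤ) else 0 := by
  rw [Finset.sum_boole]
  rfl

/-- The total weight of the words `a + c • b`, `c ≠ 0`, in terms of the number of
coordinates of the support of `b` outside the support of `a`. -/
theorem sum_hammingNorm_add_smul {ι F : Type*} [Fintype ι] [Field F] [Fintype F] [DecidableEq F]
    (a b : ι → F) :
    (∑ c ∈ (Finset.univ \ {0} : Finset F), (hammingNorm (a + c • b) : ℤ)) =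
      ((Fintype.card F : ℤ) - 1) * hammingNorm a - hammingNorm b
        + Fintype.card F * (Finset.univ.filter fun i => a i = 0 ∧ b i ≠ 0).card := by
  simp_rw [hammingNorm_eq_sum_ite]
  rw [Finset.sum_comm, Finset.natCast_card_filter, Finset.mul_sum, Finset.mul_sum,
    ← Finset.sum_sub_distrib, ← Finset.sum_add_distrib]
  exact Finset.sum_congr rfl fun i _ => sum_ite_add_mul_ne_zero (a i) (b i)

theorem sum_hammingNorm_add_smul_eq_iff {ι F : Type*} [Fintype ι] [Field F] [Fintype F]
    [DecidableEq F] (a b : ι → F) :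
    (∑ c ∈ (Finset.univ \ {0} : Finset F), (hammingNorm (a + c • b) : ℤ)) =
      ((Fintype.card F : ℤ) - 1) * hammingNorm a - hammingNorm b ↔
        ∀ i, b i ≠ 0 → a i ≠ 0 := by
  rw [sum_hammingNorm_add_smul, add_eq_left, mul_eq_zero]
  simp only [Nat.cast_eq_zero, Fintype.card_ne_zero, false_or, Finset.card_eq_zero,
    Finset.filter_eq_empty_iff, Finset.mem_univ, forall_const]
  exact ⟨fun h i hb ha => h ⟨ha, hb⟩, fun h i hi => h i hi.2 hi.1⟩


/-- A linear code `C ⊆ GF(q)^n` is minimal iff for all linearly independent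
codewords `a, b ∈ C`, `∑_{c ≠ 0} wt(a + c•b) ≠ (q-1)·wt(a) - wt(b)`. -/
theorem stmt_8 {n : ℕ} {F : Type*} [Field F] [Fintype F] [DecidableEq F]
    (hq : IsPrimePow (Fintype.card F)) (C : Submodule F (Fin n → F)) :
    (∀ u ∈ C, ∀ v ∈ C, (∀ i, v i ≠ 0 → u i ≠ 0) → ∃ a : F, v = a • u) ↔
      ∀ a ∈ C, ∀ b ∈ C, LinearIndependent F ![a, b] →
        (∑ c ∈ (Finset.univ \ {0} : Finset F), (hammingNorm (a + c • b) : ℤ))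
          ≠ ((Fintype.card F : ℤ) - 1) * hammingNorm a - hammingNorm b := by
  simp only [ne_eq, sum_hammingNorm_add_smul_eq_iff]
  constructor
  · intro h a ha b hb hab hcov
    obtain ⟨x, hx⟩ := h a ha b hb hcov
    have ha0 : a ≠ 0 := hab.ne_zero 0
    exact (LinearIndependent.pair_iff' ha0).1 hab x hx.symm
  · intro h u hu v hv hcov
    by_contra! hne
    have hu0 : u ≠ 0 := by
      rintro rfl
      refine hne 0 (funext fun i => ?_)
      by_contra hvi
      exact hcov i (by simpa using hvi) rfl
    exact h u hu v hv ((LinearIndependent.pair_iff' hu0).2 fun x hx => hne x hx.symm) hcov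
end

section
/- Let q be a prime power and let C be a linear code in GF(q)^n all of whose nonzero codewords have Hamming weight w_1 or w_2, where 0 < w_1 < w_2 < n. If j*w_1 is not equal to (j-1)*w_2 for every integer j with 2 <= j <= q, then C is a minimal linear code. -/
/-- If `u` covers `v`, the weights of the vectors `v - a • u`, with `a` ranging over the field,
add up to `(q - 1) * wt(u)`. -/
theorem sum_hammingNorm_sub_smul {n : ℕ} {F : Type*} [Field F] [Fintype F] [DecidableEq F]
    (u v : Fin n → F) (huv : ∀ i, v i ≠ 0 → u i ≠ 0) :
    ∑ a : F, hammingNorm (v - a • u) = (Fintype.card F - 1) * hammingNorm u := by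
  have key (i : Fin n) : ∑ a : F, (if (v - a • u) i ≠ 0 then 1 else 0) =
      (Fintype.card F - 1) * (if u i ≠ 0 then 1 else 0) := by
    by_cases hu : u i = 0
    · have hv : v i = 0 := by
        by_contra hv
        exact huv i hv hu
      simp [hu, hv]
    · have h1 (a : F) : (v - a • u) i ≠ 0 ↔ a ≠ v i / u i := by
        rw [Pi.sub_apply, Pi.smul_apply, smul_eq_mul, sub_ne_zero, ne_comm, Ne, Ne, eq_div_iff hu]
      simp_rw [h1]
      rw [← Finset.card_filter, Finset.filter_ne', Finset.card_erase_of_mem (Finset.mem_univ _)]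
      simp [hu]
  simp_rw [hammingNorm, Finset.card_filter]
  rw [Finset.sum_comm, Finset.sum_congr rfl fun i _ => key i, Finset.mul_sum]

/-- A two-weight linear code `C ⊆ GF(q)^n` with nonzero weights `0 < w₁ < w₂ < n`
is minimal provided `j·w₁ ≠ (j-1)·w₂` for all `2 ≤ j ≤ q`. -/
theorem stmt_9 {n : ℕ} {F : Type*} [Field F] [Fintype F] [DecidableEq F]
    (hq : IsPrimePow (Fintype.card F)) (C : Submodule F (Fin n → F))
    (w₁ w₂ : ℕ) (hw₁ : 0 < w₁) (hw₁₂ : w₁ < w₂) (hw₂ : w₂ < n)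
    (hweights : ∀ v ∈ C, v ≠ 0 → hammingNorm v = w₁ ∨ hammingNorm v = w₂)
    (h : ∀ j : ℕ, 2 ≤ j → j ≤ Fintype.card F → j * w₁ ≠ (j - 1) * w₂) :
    ∀ u ∈ C, ∀ v ∈ C, (∀ i, v i ≠ 0 → u i ≠ 0) → ∃ a : F, v = a • u := by
  intro u hu v hv huv
  by_contra! hne
  have hu0 : u ≠ 0 := by
    rintro rfl
    refine hne 0 (funext fun i => ?_)
    by_contra hvi
    exact huv i (by simpa using hvi) rfl
  have hwt (a : F) : hammingNorm (v - a • u) = w₁ ∨ hammingNorm (v - a • u) = w₂ :=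
    hweights _ (C.sub_mem hv (C.smul_mem a hu)) (sub_ne_zero.mpr (hne a))
  have hsum := sum_hammingNorm_sub_smul u v huv
  set t := (Finset.univ.filter fun a : F => hammingNorm (v - a • u) = w₁).card with ht
  obtain ⟨s, hs⟩ : ∃ s, t + s = Fintype.card F :=
    ⟨_, Finset.card_filter_add_card_filter_not (s := Finset.univ) _⟩
  have hcount : ∑ a : F, hammingNorm (v - a • u) = t * w₁ + s * w₂ := by
    have hite (a : F) : hammingNorm (v - a • u) =
        if hammingNorm (v - a • u) = w₁ then w₁ else w₂ := by
      split_ifs with h1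
      · exact h1
      · exact (hwt a).resolve_left h1
    have hs' := Finset.card_filter_add_card_filter_not (s := Finset.univ)
      (fun a : F => hammingNorm (v - a • u) = w₁)
    rw [Finset.card_univ, ← hs, ← ht, Nat.add_left_cancel_iff] at hs'
    rw [Finset.sum_congr rfl fun a _ => hite a, Finset.sum_ite, Finset.sum_const, Finset.sum_const,
      hs', smul_eq_mul, smul_eq_mul]
  have hpos : 1 ≤ t + s := hs ▸ Fintype.card_pos
  rw [hcount, ← hs] at hsum
  obtain ⟨r, hr⟩ := Nat.exists_eq_add_of_le' hpos
  rw [hr, Nat.add_sub_cancel] at hsum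
  rcases hweights u hu hu0 with h1 | h2
  · rw [h1] at hsum
    nlinarith [Nat.mul_le_mul_left s hw₁₂.le, congrArg (· * w₁) hr]
  · rw [h2] at hsum
    rcases t with _ | _ | k
    · have hrs : s = r + 1 := by omega
      subst hrs
      nlinarith
    · have hrs : s = r := by omega
      subst hrs
      nlinarith
    · refine h (k + 2) (by omega) (by omega) ?_
      have hrs : r = k + 1 + s := by omega
      subst hrs
      rw [show k + 2 - 1 = k + 1 by omega]
      nlinarith
end

section
/- Let m and k be integers with m >= 5 and 2 <= k <= floor((m-1)/2), and let g_{(m,k)} be the function from GF(3)^m to GF(3) taking value 1 on vectors of Hamming weight between 1 and k and value 0 otherwise. Then the linear code C_{g_{(m,k)}} is a minimal linear code of length 3^m - 1, dimension m+1, and minimum distance sum over j from 1 to k of 2^j * binomial(m,j). -/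
/-- The codeword of `C_f` attached to `u ∈ GF(3)` and `v ∈ GF(3)^m`, indexed by
the nonzero vectors of `GF(3)^m`. -/
def codeword (m : ℕ) (f : (Fin m → ZMod 3) → ZMod 3) (u : ZMod 3) (v : Fin m → ZMod 3) :
    {x : Fin m → ZMod 3 // x ≠ 0} → ZMod 3 :=
  fun x => u * f x.val + ∑ i, v i * x.val i

/-- The code `C_f` as a set of vectors indexed by `GF(3)^m \ {0}`. -/
def codeSet (m : ℕ) (f : (Fin m → ZMod 3) → ZMod 3) :
    Set ({x : Fin m → ZMod 3 // x ≠ 0} → ZMod 3) :=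
  {c | ∃ u v, c = codeword m f u v}

/-- `g_{(m,k)} : GF(3)^m → GF(3)` takes value `1` on the vectors of Hamming
weight between `1` and `k`, and `0` otherwise. -/
def gmk (m k : ℕ) : (Fin m → ZMod 3) → ZMod 3 :=
  fun x => if 1 ≤ hammingNorm x ∧ hammingNorm x ≤ k then 1 else 0

/-- A functional on `GF(3)^m` vanishing wherever `v ⬝ᵥ ·` vanishes is a multiple of it. -/
theorem exists_smul_eq_of_dotProduct_eq_zero {m : ℕ} (v w : Fin m → ZMod 3)
    (h : ∀ x, v ⬝ᵥ x = 0 → w ⬝ᵥ x = 0) : ∃ t : ZMod 3, w = t • v := by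
  by_cases hv : v = 0
  · refine ⟨0, funext fun i => ?_⟩
    simpa using h (Pi.single i 1) (by simp [hv])
  · obtain ⟨i, hi⟩ := Function.ne_iff.mp hv
    have hi' : v i ≠ 0 := hi
    refine ⟨w i / v i, funext fun j => ?_⟩
    have := h (v j • Pi.single i 1 - v i • Pi.single j 1)
      (by simp [dotProduct_sub, mul_comm])
    simp only [dotProduct_sub, dotProduct_smul, dotProduct_single_one, smul_eq_mul] at this
    simp only [Pi.smul_apply, smul_eq_mul]
    field_simp
    linear_combination -this

/-- Two linear equations in three unknowns have a nontrivial solution. -/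
theorem exists_ne_zero_of_two_equations (p q : Fin 3 → ZMod 3) :
    ∃ y : Fin 3 → ZMod 3, y ≠ 0 ∧ p ⬝ᵥ y = 0 ∧ q ⬝ᵥ y = 0 := by
  obtain ⟨y, hy, h⟩ := (Matrix.exists_mulVec_eq_zero_iff (M := Matrix.of ![p, q, 0])).mpr
    (by simp [Matrix.det_fin_three])
  exact ⟨y, hy, congrFun h 0, congrFun h 1⟩

theorem card_eq_zero_add_hammingNorm {m : ℕ} (x : Fin m → ZMod 3) :
    (Finset.univ.filter fun i => x i = 0).card + hammingNorm x = m := by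
  simpa [hammingNorm] using
    Finset.card_filter_add_card_filter_not (s := (Finset.univ : Finset (Fin m))) (fun i => x i = 0)

/-- A vector with at least three zeros can be made heavier without changing its inner products
with two given vectors. -/
theorem exists_hammingNorm_lt {m : ℕ} (v w x : Fin m → ZMod 3) (hx : hammingNorm x + 2 < m) :
    ∃ z, v ⬝ᵥ z = v ⬝ᵥ x ∧ w ⬝ᵥ z = w ⬝ᵥ x ∧ hammingNorm x < hammingNorm z := by
  have hc := card_eq_zero_add_hammingNorm x
  obtain ⟨a, ha, b, hb, c, hcx, hab, hac, hbc⟩ :=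
    Finset.two_lt_card.mp (show 2 < (Finset.univ.filter fun i => x i = 0).card by omega)
  simp only [Finset.mem_filter, Finset.mem_univ, true_and] at ha hb hcx
  obtain ⟨y, hy, hv, hw⟩ := exists_ne_zero_of_two_equations ![v a, v b, v c] ![w a, w b, w c]
  simp only [dotProduct, Fin.sum_univ_three, Matrix.cons_val_zero, Matrix.cons_val_one,
    Matrix.cons_val] at hv hw
  set z := x + (Pi.single a (y 0) + Pi.single b (y 1) + Pi.single c (y 2)) with hz
  have hza : z a = y 0 := by simp [hz, ha, hab, hac]
  have hzb : z b = y 1 := by simp [hz, hb, hab.symm, hbc]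
  have hzc : z c = y 2 := by simp [hz, hcx, hac.symm, hbc.symm]
  have hzi : ∀ i, x i ≠ 0 → z i = x i := by
    intro i hi
    have h1 : i ≠ a := fun h => hi (h ▸ ha)
    have h2 : i ≠ b := fun h => hi (h ▸ hb)
    have h3 : i ≠ c := fun h => hi (h ▸ hcx)
    simp [hz, h1, h2, h3]
  refine ⟨z, by simp [hz, dotProduct_add, hv], by simp [hz, dotProduct_add, hw],
    Finset.card_lt_card ?_⟩
  rw [Finset.ssubset_iff_of_subset]
  · obtain ⟨j, hj⟩ := Function.ne_iff.mp hy
    fin_cases j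
    · exact ⟨a, by simpa [hza] using hj, by simpa using ha⟩
    · exact ⟨b, by simpa [hzb] using hj, by simpa using hb⟩
    · exact ⟨c, by simpa [hzc] using hj, by simpa using hcx⟩
  · intro i hi
    simp only [Finset.mem_filter, Finset.mem_univ, true_and] at hi ⊢
    rwa [hzi i hi]

/-- The hyperplane `v ⬝ᵥ x = 0`, minus another hyperplane, contains a vector with at most two
zeros as soon as it is nonempty. -/
theorem exists_heavy_vector {m : ℕ} (v w : Fin m → ZMod 3)
    (h : ∃ x, v ⬝ᵥ x = 0 ∧ w ⬝ᵥ x ≠ 0) :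
    ∃ x, v ⬝ᵥ x = 0 ∧ w ⬝ᵥ x ≠ 0 ∧ m ≤ hammingNorm x + 2 := by
  obtain ⟨x, hx, hmax⟩ := Set.exists_max_image {x | v ⬝ᵥ x = 0 ∧ w ⬝ᵥ x ≠ 0} hammingNorm
    (Set.toFinite _) h
  refine ⟨x, hx.1, hx.2, ?_⟩
  by_contra! hlt
  obtain ⟨z, hvz, hwz, hz⟩ := exists_hammingNorm_lt v w x hlt
  exact absurd (hmax z ⟨hvz.trans hx.1, hwz ▸ hx.2⟩) (by omega)

theorem hammingNorm_single {m : ℕ} (i : Fin m) {t : ZMod 3} (ht : t ≠ 0) :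
    hammingNorm (Pi.single i t : Fin m → ZMod 3) = 1 := by
  rw [hammingNorm, Finset.card_eq_one]
  refine ⟨i, ?_⟩
  ext j
  by_cases h : j = i
  · subst h; simpa using ht
  · simp [h]

theorem gmk_single {m k : ℕ} (hk : 1 ≤ k) (i : Fin m) {t : ZMod 3} (ht : t ≠ 0) :
    gmk m k (Pi.single i t) = 1 := by
  simp [gmk, hammingNorm_single i ht, hk]

theorem gmk_zero (m k : ℕ) : gmk m k 0 = 0 := by
  simp [gmk]

theorem gmk_neg (m k : ℕ) (x : Fin m → ZMod 3) : gmk m k (-x) = gmk m k x := by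
  simp [gmk, hammingNorm]

theorem codeword_apply {m : ℕ} (f : (Fin m → ZMod 3) → ZMod 3) (u : ZMod 3) (v : Fin m → ZMod 3)
    (x : {x : Fin m → ZMod 3 // x ≠ 0}) : codeword m f u v x = u * f x.val + v ⬝ᵥ x.val :=
  rfl

theorem codeword_sub {m : ℕ} (f : (Fin m → ZMod 3) → ZMod 3) (u u' : ZMod 3)
    (v v' : Fin m → ZMod 3) :
    codeword m f (u - u') (v - v') = codeword m f u v - codeword m f u' v' := by
  ext x
  simp only [codeword_apply, Pi.sub_apply, sub_dotProduct]
  ring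

theorem codeword_smul {m : ℕ} (f : (Fin m → ZMod 3) → ZMod 3) (t u : ZMod 3)
    (v : Fin m → ZMod 3) : codeword m f (t * u) (t • v) = t • codeword m f u v := by
  ext x
  simp only [codeword_apply, Pi.smul_apply, smul_dotProduct, smul_eq_mul]
  ring

theorem eq_zero_of_codeword_eq_zero {m k : ℕ} (hm : 0 < m) (hk : 1 ≤ k) {u : ZMod 3}
    {v : Fin m → ZMod 3} (h : codeword m (gmk m k) u v = 0) : u = 0 ∧ v = 0 := by
  have key : ∀ (i : Fin m) (t : ZMod 3), t ≠ 0 → u + v i * t = 0 := by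
    intro i t ht
    have := congrFun h ⟨Pi.single i t, by simpa using ht⟩
    simpa [codeword_apply, gmk_single hk i ht] using this
  have key' : ∀ i, u = 0 ∧ v i = 0 := by
    intro i
    have h1 := key i 1 (by decide)
    have h2 := key i 2 (by decide)
    generalize v i = a at h1 h2
    clear h key
    revert u a
    decide
  exact ⟨(key' ⟨0, hm⟩).1, funext fun i => (key' i).2⟩

theorem codeword_injective {m k : ℕ} (hm : 0 < m) (hk : 1 ≤ k) :
    Function.Injective fun p : ZMod 3 × (Fin m → ZMod 3) => codeword m (gmk m k) p.1 p.2 := by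
  intro p q h
  have := eq_zero_of_codeword_eq_zero hm hk
    ((codeword_sub (gmk m k) p.1 q.1 p.2 q.2).trans (sub_eq_zero.mpr h))
  exact Prod.ext (sub_eq_zero.mp this.1) (sub_eq_zero.mp this.2)

theorem ncard_codeSet {m k : ℕ} (hm : 0 < m) (hk : 1 ≤ k) :
    (codeSet m (gmk m k)).ncard = 3 ^ (m + 1) := by
  have : codeSet m (gmk m k) =
      Set.range fun p : ZMod 3 × (Fin m → ZMod 3) => codeword m (gmk m k) p.1 p.2 := by
    ext c
    simp [codeSet, eq_comm]
  rw [this, ← Set.image_univ, Set.ncard_image_of_injective _ (codeword_injective hm hk),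
    Set.ncard_univ]
  simp [pow_succ, mul_comm]

theorem eq_zero_of_covered {m k : ℕ} (hk1 : 1 ≤ k) (hk : k + 2 < m) (v w : Fin m → ZMod 3)
    (h : ∀ x, gmk m k x + v ⬝ᵥ x = 0 → w ⬝ᵥ x = 0) : w = 0 := by
  obtain ⟨t, rfl⟩ := exists_smul_eq_of_dotProduct_eq_zero v w (by
    by_contra! hne
    obtain ⟨x, hvx, hwx, hx⟩ := exists_heavy_vector v w hne
    refine hwx (h x ?_)
    have : ¬ hammingNorm x ≤ k := by omega
    simp [gmk, this, hvx])
  by_cases hv : v = 0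
  · simp [hv]
  obtain ⟨i, hi⟩ := Function.ne_iff.mp hv
  have hi' : v i ≠ 0 := hi
  have := h (Pi.single i (-(v i)⁻¹)) (by
    rw [gmk_single hk1 i (by simpa using hi')]
    simp [hi'])
  have ht : t = 0 := by simpa [hi'] using this
  simp [ht]

/-- `gmk` does not agree with a linear functional on any hyperplane. -/
theorem eq_zero_of_linear_on_hyperplane {m k : ℕ} (hm : 2 ≤ m) (hk : 2 ≤ k) (u : ZMod 3)
    (v w : Fin m → ZMod 3) (h : ∀ x, v ⬝ᵥ x = 0 → u * gmk m k x + w ⬝ᵥ x = 0) : u = 0 := by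
  obtain ⟨x, hx, hvx, hxk⟩ : ∃ x : Fin m → ZMod 3, x ≠ 0 ∧ v ⬝ᵥ x = 0 ∧ hammingNorm x ≤ 2 := by
    set i : Fin m := ⟨0, by omega⟩
    set j : Fin m := ⟨1, by omega⟩
    have hij : i ≠ j := by simp [i, j]
    obtain ⟨a, b, hab, hv⟩ : ∃ a b : ZMod 3, (a ≠ 0 ∨ b ≠ 0) ∧ v i * a + v j * b = 0 := by
      generalize v i = p
      generalize v j = q
      revert p q
      decide
    refine ⟨Pi.single i a + Pi.single j b, fun h0 => ?_, by simpa [dotProduct_add] using hv, ?_⟩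
    · have h1 := congrFun h0 i
      have h2 := congrFun h0 j
      simp [hij, hij.symm] at h1 h2
      tauto
    · refine (Finset.card_le_card (t := {i, j}) fun l hl => ?_).trans Finset.card_le_two
      by_contra hl'
      simp only [Finset.mem_insert, Finset.mem_singleton, not_or] at hl'
      simp [hl'.1, hl'.2] at hl
  have hg : gmk m k x = 1 := by
    have := hammingNorm_pos_iff.mpr hx
    simp only [gmk]
    rw [if_pos ⟨this, by omega⟩]
  have h1 := h x hvx
  have h2 := h (-x) (by simp [hvx])
  rw [gmk_neg] at h2
  rw [hg] at h1 h2
  rw [dotProduct_neg] at h2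
  generalize w ⬝ᵥ x = d at h1 h2
  clear h
  revert u d
  decide

theorem minimal_codeSet {m k : ℕ} (hk2 : 2 ≤ k) (hk : k + 2 < m) :
    ∀ a ∈ codeSet m (gmk m k), ∀ b ∈ codeSet m (gmk m k),
      (∀ x, b x ≠ 0 → a x ≠ 0) → ∃ t : ZMod 3, b = t • a := by
  rintro a ⟨u, v, rfl⟩ b ⟨u', v', rfl⟩ h
  have h' : ∀ x, u * gmk m k x + v ⬝ᵥ x = 0 → u' * gmk m k x + v' ⬝ᵥ x = 0 := by
    intro x hx
    by_cases hx0 : x = 0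
    · simp [hx0, gmk_zero]
    · by_contra hne
      exact h ⟨x, hx0⟩ hne hx
  by_cases hu : u = 0
  · subst hu
    have hu' : u' = 0 := eq_zero_of_linear_on_hyperplane (by omega) hk2 u' v v'
      fun x hx => h' x (by simpa using hx)
    subst hu'
    obtain ⟨t, rfl⟩ := exists_smul_eq_of_dotProduct_eq_zero v v' fun x hx => by
      simpa using h' x (by simpa using hx)
    exact ⟨t, by simpa using codeword_smul (gmk m k) t 0 v⟩
  · refine ⟨u' / u, ?_⟩
    have hw := eq_zero_of_covered (by omega) hk (u⁻¹ • v) (v' - (u' / u) • v) fun x hx => by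
      have hx' : u * gmk m k x + v ⬝ᵥ x = 0 := by
        simp only [smul_dotProduct, smul_eq_mul] at hx
        field_simp at hx
        linear_combination hx
      have := h' x hx'
      simp only [sub_dotProduct, smul_dotProduct, smul_eq_mul]
      field_simp
      linear_combination u * this - u' * hx'
    rw [sub_eq_zero.mp hw, ← codeword_smul]
    congr 1
    field_simp

theorem card_support_eq {m : ℕ} (s : Finset (Fin m)) :
    (Finset.univ.filter fun x : Fin m → ZMod 3 =>
      (Finset.univ.filter fun i => x i ≠ 0) = s).card = 2 ^ s.card := by
  have : (Finset.univ.filter fun x : Fin m → ZMod 3 =>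
      (Finset.univ.filter fun i => x i ≠ 0) = s) =
      Fintype.piFinset fun i => if i ∈ s then {0}ᶜ else {0} := by
    ext x
    simp only [Finset.mem_filter, Finset.mem_univ, true_and, Fintype.mem_piFinset,
      Finset.ext_iff]
    refine forall_congr' fun i => ?_
    by_cases hi : i ∈ s <;> simp [hi]
  have h2 : ({0}ᶜ : Finset (ZMod 3)).card = 2 := by decide
  rw [this, Fintype.card_piFinset]
  simp [apply_ite Finset.card, h2]

theorem card_hammingNorm_eq (m j : ℕ) :
    (Finset.univ.filter fun x : Fin m → ZMod 3 => hammingNorm x = j).card =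
      2 ^ j * m.choose j := by
  rw [Finset.card_eq_sum_card_fiberwise (t := Finset.univ.powersetCard j)
    (f := fun x : Fin m → ZMod 3 => Finset.univ.filter fun i => x i ≠ 0)
    (fun x hx => by simpa [hammingNorm] using hx)]
  rw [Finset.sum_congr rfl (g := fun _ => 2 ^ j)]
  · simp [mul_comm]
  · intro s hs
    rw [Finset.mem_powersetCard] at hs
    rw [← hs.2, ← card_support_eq, Finset.filter_filter]
    congr 1
    ext x
    simp only [Finset.mem_filter, Finset.mem_univ, true_and, and_iff_right_iff_imp]
    rintro rfl
    rfl

theorem card_gmk_support (m k : ℕ) :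
    (Finset.univ.filter fun x : Fin m → ZMod 3 => gmk m k x ≠ 0).card =
      ∑ j ∈ Finset.Icc 1 k, 2 ^ j * m.choose j := by
  rw [Finset.card_eq_sum_card_fiberwise (t := Finset.Icc 1 k) (f := hammingNorm)
    (fun x hx => by simpa [gmk] using hx)]
  refine Finset.sum_congr rfl fun j hj => ?_
  rw [← card_hammingNorm_eq, Finset.filter_filter]
  congr 1
  ext x
  simp only [Finset.mem_filter, Finset.mem_univ, true_and, and_iff_right_iff_imp]
  rintro rfl
  simpa [gmk] using hj

/-- Fewer than a third of the vectors of `GF(3)^m` are supported on less than half of the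
coordinates. -/
theorem sum_choose_le {m k : ℕ} (hk : 2 * k < m) :
    ∑ j ∈ Finset.Icc 1 k, 2 ^ j * m.choose j ≤ 3 ^ (m - 1) := by
  have hsum : 3 ^ m = ∑ j ∈ Finset.range (m + 1), 2 ^ j * m.choose j := by
    simpa using add_pow (2 : ℕ) 1 m
  have hrefl : ∑ j ∈ Finset.Icc 1 k, 2 * (2 ^ j * m.choose j) ≤
      ∑ j ∈ (Finset.Icc 1 k).image (m - ·), 2 ^ j * m.choose j := by
    rw [Finset.sum_image fun a ha b hb h => by
      simp only [Finset.coe_Icc, Set.mem_Icc] at ha hb h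
      omega]
    refine Finset.sum_le_sum fun j hj => ?_
    rw [Finset.mem_Icc] at hj
    rw [Nat.choose_symm (by omega), ← mul_assoc, ← pow_succ']
    exact Nat.mul_le_mul_right _ (Nat.pow_le_pow_right (by norm_num) (by omega))
  have hdisj : Disjoint (Finset.Icc 1 k) ((Finset.Icc 1 k).image (m - ·)) := by
    rw [Finset.disjoint_left]
    intro a ha hb
    simp only [Finset.mem_image, Finset.mem_Icc] at ha hb
    obtain ⟨b, hb, rfl⟩ := hb
    omega
  have hle : ∑ j ∈ Finset.Icc 1 k ∪ (Finset.Icc 1 k).image (m - ·), 2 ^ j * m.choose j ≤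
      3 ^ m := by
    rw [hsum]
    refine Finset.sum_le_sum_of_subset fun a ha => ?_
    simp only [Finset.mem_union, Finset.mem_image, Finset.mem_Icc, Finset.mem_range] at ha ⊢
    obtain ha | ⟨b, hb, rfl⟩ := ha <;> omega
  rw [Finset.sum_union hdisj] at hle
  rw [← Finset.mul_sum] at hrefl
  obtain ⟨n, rfl⟩ : ∃ n, m = n + 1 := ⟨m - 1, by omega⟩
  rw [pow_succ] at hle
  simp only [Nat.add_sub_cancel]
  omega

theorem card_dotProduct_ne_zero {m : ℕ} (v : Fin m → ZMod 3) (hv : v ≠ 0) :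
    (Finset.univ.filter fun x : Fin m → ZMod 3 => v ⬝ᵥ x ≠ 0).card = 2 * 3 ^ (m - 1) := by
  obtain ⟨i, hi⟩ := Function.ne_iff.mp hv
  have hi' : v i ≠ 0 := hi
  have hfib : ∀ c : ZMod 3, (Finset.univ.filter fun x : Fin m → ZMod 3 => v ⬝ᵥ x = c).card =
      (Finset.univ.filter fun x : Fin m → ZMod 3 => v ⬝ᵥ x = 0).card := by
    intro c
    refine Finset.card_equiv (Equiv.subRight (Pi.single i (c / v i))) fun x => ?_
    simp [dotProduct_sub, mul_div_cancel₀, hi', sub_eq_zero]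
  have htot := Finset.card_eq_sum_card_fiberwise (s := (Finset.univ : Finset (Fin m → ZMod 3)))
    (t := Finset.univ) (f := fun x => v ⬝ᵥ x) (fun _ _ => by simp)
  rw [Finset.sum_congr rfl fun c _ => hfib c] at htot
  have hsplit := Finset.card_filter_add_card_filter_not
    (s := (Finset.univ : Finset (Fin m → ZMod 3))) (fun x => v ⬝ᵥ x = 0)
  simp only [Finset.card_univ, Fintype.card_fun, ZMod.card, Fintype.card_fin, Finset.sum_const,
    smul_eq_mul] at htot hsplit
  obtain ⟨n, rfl⟩ : ∃ n, m = n + 1 := ⟨m - 1, by have := i.pos; omega⟩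
  rw [pow_succ] at htot hsplit
  simp only [Nat.add_sub_cancel, ne_eq]
  omega

theorem hammingNorm_codeword (m k : ℕ) (u : ZMod 3) (v : Fin m → ZMod 3) :
    hammingNorm (codeword m (gmk m k) u v) =
      (Finset.univ.filter fun x : Fin m → ZMod 3 => u * gmk m k x + v ⬝ᵥ x ≠ 0).card := by
  rw [hammingNorm]
  refine Finset.card_bij (fun x _ => x.val) (fun x hx => ?_) (fun _ _ _ _ h => Subtype.ext h)
    fun x hx => ?_
  · exact Finset.mem_filter.mpr ⟨Finset.mem_univ _, (Finset.mem_filter.mp hx).2⟩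
  · have hx' := (Finset.mem_filter.mp hx).2
    have hx0 : x ≠ 0 := by
      rintro rfl
      simp [gmk_zero] at hx'
    exact ⟨⟨x, hx0⟩, Finset.mem_filter.mpr ⟨Finset.mem_univ _, hx'⟩, rfl⟩

theorem le_hammingNorm_codeword {m k : ℕ} (hk : 2 * k < m) (u : ZMod 3) (v : Fin m → ZMod 3)
    (h : codeword m (gmk m k) u v ≠ 0) :
    ∑ j ∈ Finset.Icc 1 k, 2 ^ j * m.choose j ≤ hammingNorm (codeword m (gmk m k) u v) := by
  have hN := sum_choose_le hk
  rw [hammingNorm_codeword]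
  by_cases hv : v = 0
  · have hu : u ≠ 0 := by
      rintro rfl
      refine h (funext fun x => ?_)
      simp [codeword_apply, hv]
    rw [← card_gmk_support]
    simp [hv, hu]
  have hH := card_dotProduct_ne_zero v hv
  rw [← card_gmk_support] at hN ⊢
  have hsub : (Finset.univ.filter fun x : Fin m → ZMod 3 => v ⬝ᵥ x ≠ 0) ⊆
      (Finset.univ.filter fun x : Fin m → ZMod 3 => u * gmk m k x + v ⬝ᵥ x ≠ 0) ∪
      (Finset.univ.filter fun x : Fin m → ZMod 3 => gmk m k x ≠ 0) := by
    intro x hx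
    by_cases hg : gmk m k x = 0 <;> simp_all
  have := (Finset.card_le_card hsub).trans (Finset.card_union_le _ _)
  omega

/-- For `m ≥ 5` and `2 ≤ k ≤ ⌊(m-1)/2⌋`, the code `C_{g_{(m,k)}}` is a minimal
linear code of length `3^m - 1`, dimension `m+1` (i.e. with `3^(m+1)` codewords),
and minimum distance `∑_{j=1}^k 2^j·C(m,j)`. -/
theorem stmt_18 (m k : ℕ) (hm : 5 ≤ m) (hk2 : 2 ≤ k) (hk : k ≤ (m - 1) / 2) :
    Fintype.card {x : Fin m → ZMod 3 // x ≠ 0} = 3 ^ m - 1 ∧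
    (codeSet m (gmk m k)).ncard = 3 ^ (m + 1) ∧
    (∀ a ∈ codeSet m (gmk m k), ∀ b ∈ codeSet m (gmk m k),
      (∀ x, b x ≠ 0 → a x ≠ 0) → ∃ t : ZMod 3, b = t • a) ∧
    sInf {w : ℕ | ∃ c ∈ codeSet m (gmk m k), c ≠ 0 ∧ hammingNorm c = w}
      = ∑ j ∈ Finset.Icc 1 k, 2 ^ j * m.choose j := by
  have hkm : 2 * k < m := by omega
  refine ⟨?_, ncard_codeSet (by omega) (by omega), minimal_codeSet hk2 (by omega), ?_⟩
  · rw [Fintype.card_subtype_compl]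
    simp
  · have hc : codeword m (gmk m k) 1 0 ≠ 0 := fun h =>
      one_ne_zero (eq_zero_of_codeword_eq_zero (by omega) (by omega) h).1
    refine IsLeast.csInf_eq ⟨⟨_, ⟨1, 0, rfl⟩, hc, ?_⟩, ?_⟩
    · rw [hammingNorm_codeword, ← card_gmk_support]
      simp
    · rintro _ ⟨_, ⟨u, v, rfl⟩, hne, rfl⟩
      exact le_hammingNorm_codeword hkm u v hne
end
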